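/- Let n ≥ 1, 0 < α < 2n, 1 < p₁, p₂ < ∞. There is a constant C depending only on n, α, p₁, p₂ such that: whenever b ∈ BMO(ℝⁿ) with ‖b‖_* = 1, Q is a cube with center x_Q, f₁ is supported in Q with |f₁| ≤ 2|Q|^{−1/p₁} pointwise, f₂ is supported in Q with |f₂| ≤ 2|Q|^{−1/p₂} pointwise and ∫_Q f₂ = 0, and x ∈ (2√n Q)^c, then |I_α((b − b_Q) f₁, f₂)(x)| ≤ C |Q|^{1/p₁' + 1/p₂' + 1/n} |x − x_Q|^{−2n + α − 1}, where 1/p_i' = 1 − 1/p_i. -/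

import Mathlib

open MeasureTheory Filter
open scoped ENNReal Topology

noncomputable section

/-- Euclidean space `ℝⁿ`. -/
abbrev Rn (n : ℕ) := EuclideanSpace ℝ (Fin n)

/-- Axis-parallel closed cube with center `c` and side length `r`. -/
def cube (n : ℕ) (c : Rn n) (r : ℝ) : Set (Rn n) := {y | ∀ i, |y i - c i| ≤ r / 2}

/-- Average of `b` over a set `Q`. -/
def avg (n : ℕ) (b : Rn n → ℝ) (Q : Set (Rn n)) : ℝ :=
  (volume Q).toReal⁻¹ * ∫ x in Q, b x

/-- Mean oscillation of `b` over a set `Q`. -/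
def osc (n : ℕ) (b : Rn n → ℝ) (Q : Set (Rn n)) : ℝ :=
  (volume Q).toReal⁻¹ * ∫ x in Q, |b x - avg n b Q|

/-- The BMO seminorm `‖b‖_*`, as an extended real number (supremum of the mean
oscillations over all cubes). -/
def bmoNorm (n : ℕ) (b : Rn n → ℝ) : ℝ≥0∞ :=
  ⨆ (c : Rn n) (r : {r : ℝ // 0 < r}), ENNReal.ofReal (osc n b (cube n c r.1))

/-- `b ∈ BMO(ℝⁿ)`. -/
def MemBMO (n : ℕ) (b : Rn n → ℝ) : Prop :=
  LocallyIntegrable b volume ∧ bmoNorm n b < ⊤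

/-- `b ∈ CMO(ℝⁿ)`: `b` lies in the closure of `C_c^∞(ℝⁿ)` in the BMO seminorm. -/
def MemCMO (n : ℕ) (b : Rn n → ℝ) : Prop :=
  LocallyIntegrable b volume ∧
  ∀ ε : ℝ, 0 < ε → ∃ g : Rn n → ℝ, ContDiff ℝ (⊤ : ℕ∞) g ∧ HasCompactSupport g ∧
    bmoNorm n (fun x => b x - g x) ≤ ENNReal.ofReal ε

/-- The bilinear fractional integral operator `B_α`. -/
def Bop (n : ℕ) (α : ℝ) (f g : Rn n → ℝ) (x : Rn n) : ℝ :=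
  ∫ y, f (x - y) * g (x + y) * ‖y‖ ^ (α - n)

/-- The first commutator `[b, B_α]₁`. -/
def commB (n : ℕ) (α : ℝ) (b f g : Rn n → ℝ) (x : Rn n) : ℝ :=
  ∫ y, (b x - b y) * f y * g ((2 : ℝ) • x - y) * ‖x - y‖ ^ (α - n)

/-- The bilinear fractional integral operator `I_α`. -/
def Iop (n : ℕ) (α : ℝ) (f₁ f₂ : Rn n → ℝ) (x : Rn n) : ℝ :=
  ∫ y₁, ∫ y₂, f₁ y₁ * f₂ y₂ * (‖x - y₁‖ ^ 2 + ‖x - y₂‖ ^ 2) ^ (α / 2 - n)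

/-- The iterated commutator `[Πb⃗, I_α]` with `b⃗ = (b, b)`. -/
def commI (n : ℕ) (α : ℝ) (b f₁ f₂ : Rn n → ℝ) (x : Rn n) : ℝ :=
  ∫ y₁, ∫ y₂, (b x - b y₁) * (b x - b y₂) * f₁ y₁ * f₂ y₂ *
    (‖x - y₁‖ ^ 2 + ‖x - y₂‖ ^ 2) ^ (α / 2 - n)

/-- The Muckenhoupt class `A_p`. -/
def MemAp (n : ℕ) (p : ℝ) (w : Rn n → ℝ) : Prop :=
  ∃ C : ℝ, ∀ (c : Rn n) (r : ℝ), 0 < r →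
    ((volume (cube n c r)).toReal⁻¹ * ∫ x in cube n c r, w x) *
      ((volume (cube n c r)).toReal⁻¹ * ∫ x in cube n c r, w x ^ (-(1 / (p - 1)))) ^ (p - 1) ≤ C

/-- The bilinear weight class `A_{P,q}` with `P = (p₁, p₂)`. -/
def MemAPq (n : ℕ) (p₁ p₂ q : ℝ) (w₁ w₂ : Rn n → ℝ) : Prop :=
  ∃ C : ℝ, ∀ (c : Rn n) (r : ℝ), 0 < r →
    ((volume (cube n c r)).toReal⁻¹ * ∫ x in cube n c r, w₁ x ^ q * w₂ x ^ q) *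
      ((volume (cube n c r)).toReal⁻¹ *
          ∫ x in cube n c r, w₁ x ^ (-(1 - 1 / p₁)⁻¹)) ^ (q * (1 - 1 / p₁)) *
      ((volume (cube n c r)).toReal⁻¹ *
          ∫ x in cube n c r, w₂ x ^ (-(1 - 1 / p₂)⁻¹)) ^ (q * (1 - 1 / p₂)) ≤ C

theorem cube_eq_preimage (n : ℕ) (c : Rn n) (r : ℝ) :
    cube n c r = WithLp.ofLp ⁻¹' Set.Icc (fun i => c i - r / 2) (fun i => c i + r / 2) := by
  ext y
  simp only [cube, Set.mem_ofPred_eq, Set.mem_preimage, Set.mem_Icc, Pi.le_def, abs_le,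
    ← forall_and]
  refine forall_congr' fun i => ?_
  constructor <;> rintro ⟨h₁, h₂⟩ <;> constructor <;> linarith

theorem volume_cube_toReal (n : ℕ) (c : Rn n) {r : ℝ} (hr : 0 < r) :
    (volume (cube n c r)).toReal = r ^ n := by
  rw [cube_eq_preimage, (PiLp.volume_preserving_ofLp (Fin n)).measure_preimage
    measurableSet_Icc.nullMeasurableSet, Real.volume_Icc_pi_toReal]
  · simp only [add_sub_sub_cancel, add_halves, Finset.prod_const, Finset.card_univ,
      Fintype.card_fin]
  · intro i
    simp only
    linarith

theorem isClosed_cube (n : ℕ) (c : Rn n) (r : ℝ) : IsClosed (cube n c r) := by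
  rw [cube_eq_preimage]
  exact isClosed_Icc.preimage (PiLp.continuous_ofLp 2 _)

theorem norm_sub_le_of_mem_cube {n : ℕ} {c y : Rn n} {r : ℝ} (hr : 0 < r)
    (hy : y ∈ cube n c r) : ‖y - c‖ ≤ √n * (r / 2) := by
  rw [EuclideanSpace.norm_eq, ← Real.sqrt_sq (by positivity : 0 ≤ r / 2),
    ← Real.sqrt_mul (by positivity)]
  refine Real.sqrt_le_sqrt ?_
  calc ∑ i, ‖(y - c) i‖ ^ 2 ≤ ∑ _i : Fin n, (r / 2) ^ 2 := by
        refine Finset.sum_le_sum fun i _ => ?_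
        have h := hy i
        rw [PiLp.sub_apply, Real.norm_eq_abs]
        gcongr
    _ = n * (r / 2) ^ 2 := by simp

theorem isCompact_cube (n : ℕ) (c : Rn n) {r : ℝ} (hr : 0 < r) : IsCompact (cube n c r) :=
  (isCompact_closedBall c (√n * (r / 2))).of_isClosed_subset (isClosed_cube n c r)
    fun _ hy => mem_closedBall_iff_norm.2 (norm_sub_le_of_mem_cube hr hy)

theorem lt_norm_sub_of_notMem_cube {n : ℕ} {c x : Rn n} {r : ℝ}
    (hx : x ∉ cube n c r) : r / 2 < ‖x - c‖ := by
  simp only [cube, Set.mem_ofPred_eq, not_forall, not_le] at hx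
  obtain ⟨i, hi⟩ := hx
  refine hi.trans_le ?_
  simpa using PiLp.norm_apply_le (x - c) i

theorem setIntegral_abs_sub_avg_le {n : ℕ} {b : Rn n → ℝ} (hb : bmoNorm n b ≤ 1) (c : Rn n)
    {r : ℝ} (hr : 0 < r) :
    ∫ y in cube n c r, |b y - avg n b (cube n c r)| ≤ (volume (cube n c r)).toReal := by
  have hosc : osc n b (cube n c r) ≤ 1 := by
    rw [← ENNReal.ofReal_le_one]
    refine le_trans ?_ hb
    exact le_iSup₂ (f := fun (c : Rn n) (r : {r : ℝ // 0 < r}) =>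
      ENNReal.ofReal (osc n b (cube n c r.1))) c ⟨r, hr⟩
  have hV : 0 < (volume (cube n c r)).toReal := by
    rw [volume_cube_toReal n c hr]
    positivity
  rwa [osc, inv_mul_le_iff₀ hV, mul_one] at hosc

/-- The kernel `t ↦ (A + t²)^(-s)` has Lipschitz constant `2 s ρ^(-2s-1)` on `[ρ, ∞)`. -/
theorem abs_add_sq_rpow_neg_sub_le {A s ρ t u : ℝ} (hA : 0 ≤ A) (hs : 0 ≤ s) (hρ : 0 < ρ)
    (ht : ρ ≤ t) (hu : ρ ≤ u) :
    |(A + t ^ 2) ^ (-s) - (A + u ^ 2) ^ (-s)| ≤ 2 * s * ρ ^ (-(2 * s) - 1) * |t - u| := by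
  have hderiv : ∀ v ∈ Set.Ici ρ, HasDerivWithinAt (fun v : ℝ => (A + v ^ 2) ^ (-s))
      (2 * v * (-s) * (A + v ^ 2) ^ (-s - 1)) (Set.Ici ρ) v := by
    intro v hv
    have hv0 : 0 < v := hρ.trans_le hv
    have h := ((hasDerivAt_pow 2 v).const_add A).rpow_const (p := -s) (Or.inl (by positivity))
    simpa using h.hasDerivWithinAt
  have hbound : ∀ v ∈ Set.Ici ρ,
      ‖2 * v * (-s) * (A + v ^ 2) ^ (-s - 1)‖ ≤ 2 * s * ρ ^ (-(2 * s) - 1) := by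
    intro v hv
    have hv0 : 0 < v := hρ.trans_le hv
    have hpow : v * (v ^ 2) ^ (-s - 1) = v ^ (-(2 * s) - 1) := by
      rw [← Real.rpow_natCast, ← Real.rpow_mul hv0.le, ← Real.rpow_one_add' hv0.le]
      · congr 1
        push_cast
        ring
      · push_cast
        linarith
    calc ‖2 * v * (-s) * (A + v ^ 2) ^ (-s - 1)‖
        = 2 * s * (v * (A + v ^ 2) ^ (-s - 1)) := by
          rw [Real.norm_eq_abs, show 2 * v * (-s) * (A + v ^ 2) ^ (-s - 1)
            = -(2 * s * (v * (A + v ^ 2) ^ (-s - 1))) by ring, abs_neg, abs_of_nonneg (by positivity)]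
      _ ≤ 2 * s * (v * (v ^ 2) ^ (-s - 1)) := by
          gcongr 2 * s * (v * ?_)
          exact Real.rpow_le_rpow_of_nonpos (by positivity) (by linarith) (by linarith)
      _ ≤ 2 * s * ρ ^ (-(2 * s) - 1) := by
          rw [hpow]
          gcongr 2 * s * ?_
          exact Real.rpow_le_rpow_of_nonpos hρ hv (by linarith)
  simpa using (convex_Ici ρ).norm_image_sub_le_of_norm_hasDerivWithin_le hderiv hbound hu ht

/-- Integrating a mean zero function, supported and bounded on a cube, against a function of
oscillation at most `M` there. -/
theorem abs_integral_mul_le_of_integral_eq_zero {n : ℕ} {c : Rn n} {r B M k : ℝ} (hr : 0 < r)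
    {f g : Rn n → ℝ} (hf : Measurable f) (hg : Measurable g)
    (hsupp : ∀ y, y ∉ cube n c r → f y = 0) (hB : ∀ y, |f y| ≤ B)
    (hmean : ∫ y in cube n c r, f y = 0)
    (hM : ∀ y ∈ cube n c r, |g y - k| ≤ M) :
    |∫ y, f y * g y| ≤ (volume (cube n c r)).toReal * (B * M) := by
  have hfin : volume (cube n c r) < ⊤ := (isCompact_cube n c hr).measure_lt_top
  have hQ : MeasurableSet (cube n c r) := (isClosed_cube n c r).measurableSet
  have hfint : IntegrableOn f (cube n c r) :=
    Measure.integrableOn_of_bounded hfin.ne hf.aestronglyMeasurable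
      (ae_of_all _ fun y => (hB y : ‖f y‖ ≤ B))
  have hB0 : 0 ≤ B := (abs_nonneg _).trans (hB c)
  have hbound : ∀ y ∈ cube n c r, ‖f y * (g y - k)‖ ≤ B * M := by
    intro y hy
    rw [norm_mul]
    exact mul_le_mul (hB y) (hM y hy) (norm_nonneg _) hB0
  have hdint : IntegrableOn (fun y => f y * (g y - k)) (cube n c r) :=
    Measure.integrableOn_of_bounded hfin.ne
      (hf.mul (hg.sub measurable_const)).aestronglyMeasurable
      ((ae_restrict_iff' hQ).2 (ae_of_all _ hbound))
  have heq : ∫ y, f y * g y = ∫ y in cube n c r, f y * (g y - k) := by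
    calc ∫ y, f y * g y = ∫ y in cube n c r, f y * g y :=
          (setIntegral_eq_integral_of_forall_compl_eq_zero fun y hy => by
            rw [hsupp y hy, zero_mul]).symm
      _ = ∫ y in cube n c r, (f y * (g y - k) + f y * k) := by
          congr 1 with y
          ring
      _ = ∫ y in cube n c r, f y * (g y - k) := by
          rw [integral_add hdint (hfint.mul_const k), integral_mul_const, hmean, zero_mul,
            add_zero]
  rw [heq, mul_comm]
  exact norm_setIntegral_le_of_norm_le_const hfin hbound

theorem half_norm_le_norm_sub {n : ℕ} {c x y : Rn n} {r : ℝ} (hr : 0 < r)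
    (hx : x ∉ cube n c (2 * √n * r)) (hy : y ∈ cube n c r) : ‖x - c‖ / 2 ≤ ‖x - y‖ := by
  have h₁ := norm_sub_le_of_mem_cube hr hy
  have h₂ := lt_norm_sub_of_notMem_cube hx
  have h₃ := norm_sub_le_norm_sub_add_norm_sub x y c
  linarith

/-- pointwise upper bound `|I_α((b-b_Q)f₁, f₂)(x)| ≲
|Q|^{1/p₁'+1/p₂'+1/n} |x - x_Q|^{-2n+α-1}` for `x ∈ (2√n Q)^c`, when `f₂` has mean zero. -/
theorem statement12 (n : ℕ) (hn : 1 ≤ n) (α p₁ p₂ : ℝ)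
    (hα : 0 < α) (hαn : α < 2 * n) (hp₁ : 1 < p₁) (hp₂ : 1 < p₂) :
    ∃ C : ℝ, ∀ (b : Rn n → ℝ) (c : Rn n) (r : ℝ), 0 < r →
      LocallyIntegrable b volume → bmoNorm n b = 1 →
      ∀ f₁ f₂ : Rn n → ℝ, Measurable f₁ → Measurable f₂ →
      (∀ y, y ∉ cube n c r → f₁ y = 0) →
      (∀ y, |f₁ y| ≤ 2 * (volume (cube n c r)).toReal ^ (-(1 / p₁))) →
      (∀ y, y ∉ cube n c r → f₂ y = 0) →
      (∀ y, |f₂ y| ≤ 2 * (volume (cube n c r)).toReal ^ (-(1 / p₂))) →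
      (∫ y in cube n c r, f₂ y) = 0 →
      ∀ x : Rn n, x ∉ cube n c (2 * Real.sqrt n * r) →
        |Iop n α (fun y => (b y - avg n b (cube n c r)) * f₁ y) f₂ x| ≤
          C * (volume (cube n c r)).toReal ^ ((1 - 1 / p₁) + (1 - 1 / p₂) + 1 / n) *
            ‖x - c‖ ^ (-(2 * n) + α - 1) := by
  set s : ℝ := n - α / 2 with hs
  have hs0 : 0 < s := by rw [hs]; linarith
  refine ⟨4 * s * √n * 2 ^ (2 * s + 1), ?_⟩
  intro b c r hr hb hbmo f₁ f₂ _ hf₂ hsupp₁ hbd₁ hsupp₂ hbd₂ hmean x hx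
  set V : ℝ := (volume (cube n c r)).toReal with hV
  have hVr : V = r ^ n := volume_cube_toReal n c hr
  have hV0 : 0 < V := by rw [hVr]; positivity
  set m : ℝ := avg n b (cube n c r) with hm
  set R : ℝ := ‖x - c‖ with hR
  have hR0 : 0 < R := lt_of_le_of_lt (by positivity) (lt_norm_sub_of_notMem_cube hx)
  set M : ℝ := 2 * s * (R / 2) ^ (-(2 * s) - 1) * (√n * (r / 2)) with hM
  have hM0 : 0 ≤ M := by positivity
  have hQ : MeasurableSet (cube n c r) := (isClosed_cube n c r).measurableSet
  have hinner : ∀ y₁, |∫ y₂, f₂ y₂ * (‖x - y₁‖ ^ 2 + ‖x - y₂‖ ^ 2) ^ (α / 2 - n)|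
      ≤ V * (2 * V ^ (-(1 / p₂)) * M) := by
    intro y₁
    refine abs_integral_mul_le_of_integral_eq_zero
      (k := (‖x - y₁‖ ^ 2 + ‖x - c‖ ^ 2) ^ (α / 2 - n)) hr hf₂ (by fun_prop) hsupp₂ hbd₂ hmean
      fun y₂ hy₂ => ?_
    rw [show α / 2 - n = -s by rw [hs]; ring]
    refine (abs_add_sq_rpow_neg_sub_le (sq_nonneg _) hs0.le (half_pos hR0)
      (half_norm_le_norm_sub hr hx hy₂) (half_le_self hR0.le)).trans ?_
    rw [hM]
    gcongr
    refine (abs_norm_sub_norm_le _ _).trans ?_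
    rw [sub_sub_sub_cancel_left, norm_sub_rev]
    exact norm_sub_le_of_mem_cube hr hy₂
  have hbint : IntegrableOn (fun y => |b y - m|) (cube n c r) :=
    ((hb.integrableOn_isCompact (isCompact_cube n c hr)).sub
      (integrableOn_const (isCompact_cube n c hr).measure_lt_top.ne)).abs
  set D : ℝ := 2 * V ^ (-(1 / p₁)) * (V * (2 * V ^ (-(1 / p₂)) * M)) with hD
  have hD0 : 0 ≤ D := by positivity
  have houter : |Iop n α (fun y => (b y - m) * f₁ y) f₂ x| ≤ V * D := by
    calc |Iop n α (fun y => (b y - m) * f₁ y) f₂ x|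
        ≤ ∫ y, (cube n c r).indicator (fun y => |b y - m| * D) y := by
          rw [Iop, ← Real.norm_eq_abs]
          refine norm_integral_le_of_norm_le ((integrable_indicator_iff hQ).2 (hbint.mul_const D))
            (ae_of_all _ fun y₁ => ?_)
          simp only [mul_assoc, integral_const_mul]
          by_cases hy₁ : y₁ ∈ cube n c r
          · rw [Set.indicator_of_mem hy₁, norm_mul, norm_mul]
            refine mul_le_mul_of_nonneg_left ?_ (abs_nonneg _)
            exact mul_le_mul (hbd₁ y₁) (hinner y₁) (norm_nonneg _) (by positivity)
          · simp [Set.indicator_of_notMem hy₁, hsupp₁ y₁ hy₁]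
      _ = (∫ y in cube n c r, |b y - m|) * D := by
          rw [integral_indicator hQ, integral_mul_const]
      _ ≤ V * D :=
          mul_le_mul_of_nonneg_right (setIntegral_abs_sub_avg_le hbmo.le c hr) hD0
  refine houter.trans (le_of_eq ?_)
  have hVpow : V ^ ((1 - 1 / p₁) + (1 - 1 / p₂) + 1 / n)
      = V * V ^ (-(1 / p₁)) * (V * V ^ (-(1 / p₂))) * r := by
    have hroot : V ^ (1 / n : ℝ) = r := by
      rw [hVr, one_div, Real.pow_rpow_inv_natCast hr.le (by omega)]
    rw [Real.rpow_add hV0, hroot, Real.rpow_add hV0, sub_eq_add_neg, sub_eq_add_neg,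
      Real.rpow_add hV0, Real.rpow_add hV0, Real.rpow_one]
  have hRpow : (R / 2) ^ (-(2 * s) - 1) = 2 ^ (2 * s + 1) * R ^ (-(2 * n) + α - 1) := by
    rw [Real.div_rpow hR0.le two_pos.le, show -(2 * s) - 1 = -(2 * s + 1) by ring,
      Real.rpow_neg two_pos.le, div_inv_eq_mul, mul_comm,
      show -(2 * (n : ℝ)) + α - 1 = -(2 * s + 1) by rw [hs]; ring]
  rw [hVpow, hD, hM, hRpow]
  ring
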